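/- Let C₁, C₂, C₃ be real 2×2 matrices each of rank one, and for ε ∈ {−1,+1}³ write X_ε = ε₁C₁ + ε₂C₂ + ε₃C₃. Then every rank-one convex function f : M₂(ℝ) → ℝ satisfies f(0) ≤ (1/16)·(f(X₊₊₊) + f(X₊₋₋) + f(X₋₊₋) + f(X₋₋₊)) + (3/16)·(f(X₋₋₋) + f(X₊₊₋) + f(X₊₋₊) + f(X₋₊₊)). -/

import Mathlib

open Matrix


def RC (a b c : ℝ) (g : ℝ → ℝ → ℝ → ℝ) : Prop :=
  ∀ x y z x' y' z' l : ℝ, 0 ≤ l → l ≤ 1 →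
    a * (x - x') * (y - y') + b * (y - y') * (z - z') + c * (x - x') * (z - z') = 0 →
    g ((1 - l) * x + l * x') ((1 - l) * y + l * y') ((1 - l) * z + l * z')
      ≤ (1 - l) * g x y z + l * g x' y' z'

noncomputable def We (g : ℝ → ℝ → ℝ → ℝ) : ℝ :=
  (g 1 1 1 + g 1 1 (-1) + g 1 (-1) 1 + g 1 (-1) (-1)
    + g (-1) 1 1 + g (-1) 1 (-1) + g (-1) (-1) 1 + g (-1) (-1) (-1)) / 8
noncomputable def Wx (g : ℝ → ℝ → ℝ → ℝ) : ℝ :=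
  (g 1 1 1 + g 1 1 (-1) + g 1 (-1) 1 + g 1 (-1) (-1)
    - g (-1) 1 1 - g (-1) 1 (-1) - g (-1) (-1) 1 - g (-1) (-1) (-1)) / 8
noncomputable def Wy (g : ℝ → ℝ → ℝ → ℝ) : ℝ :=
  (g 1 1 1 + g 1 1 (-1) - g 1 (-1) 1 - g 1 (-1) (-1)
    + g (-1) 1 1 + g (-1) 1 (-1) - g (-1) (-1) 1 - g (-1) (-1) (-1)) / 8
noncomputable def Wz (g : ℝ → ℝ → ℝ → ℝ) : ℝ :=
  (g 1 1 1 - g 1 1 (-1) + g 1 (-1) 1 - g 1 (-1) (-1)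
    + g (-1) 1 1 - g (-1) 1 (-1) + g (-1) (-1) 1 - g (-1) (-1) (-1)) / 8
noncomputable def WA (g : ℝ → ℝ → ℝ → ℝ) : ℝ :=
  (g 1 1 1 - g 1 1 (-1) - g 1 (-1) 1 + g 1 (-1) (-1)
    + g (-1) 1 1 - g (-1) 1 (-1) - g (-1) (-1) 1 + g (-1) (-1) (-1)) / 8
noncomputable def WB (g : ℝ → ℝ → ℝ → ℝ) : ℝ :=
  (g 1 1 1 - g 1 1 (-1) + g 1 (-1) 1 - g 1 (-1) (-1)
    - g (-1) 1 1 + g (-1) 1 (-1) - g (-1) (-1) 1 + g (-1) (-1) (-1)) / 8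
noncomputable def WC (g : ℝ → ℝ → ℝ → ℝ) : ℝ :=
  (g 1 1 1 + g 1 1 (-1) - g 1 (-1) 1 - g 1 (-1) (-1)
    - g (-1) 1 1 - g (-1) 1 (-1) + g (-1) (-1) 1 + g (-1) (-1) (-1)) / 8
noncomputable def WX (g : ℝ → ℝ → ℝ → ℝ) : ℝ :=
  (g 1 1 1 - g 1 1 (-1) - g 1 (-1) 1 + g 1 (-1) (-1)
    - g (-1) 1 1 + g (-1) 1 (-1) + g (-1) (-1) 1 - g (-1) (-1) (-1)) / 8

noncomputable def triW (g : ℝ → ℝ → ℝ → ℝ) (x y z : ℝ) : ℝ :=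
  We g + x * Wx g + y * Wy g + z * Wz g + y * z * WA g + x * z * WB g + x * y * WC g
    + x * y * z * WX g

theorem RC.seg {a b c : ℝ} {g : ℝ → ℝ → ℝ → ℝ} (h : RC a b c g)
    {X Y Z : ℝ} (x y z x' y' z' l : ℝ) (h0 : 0 ≤ l) (h1 : l ≤ 1)
    (hn : a * (x - x') * (y - y') + b * (y - y') * (z - z') + c * (x - x') * (z - z') = 0)
    (hX : X = (1 - l) * x + l * x') (hY : Y = (1 - l) * y + l * y')
    (hZ : Z = (1 - l) * z + l * z') :
    g X Y Z ≤ (1 - l) * g x y z + l * g x' y' z' := by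
  subst hX hY hZ; exact h x y z x' y' z' l h0 h1 hn

theorem RC.ax1 {a b c : ℝ} {g : ℝ → ℝ → ℝ → ℝ} (h : RC a b c g) (x y z : ℝ)
    (h0 : -1 ≤ x) (h1 : x ≤ 1) :
    g x y z ≤ (1 - (1 + x) / 2) * g (-1) y z + (1 + x) / 2 * g 1 y z :=
  h.seg (-1) y z 1 y z ((1 + x) / 2) (by linarith) (by linarith) (by ring) (by ring) (by ring)
    (by ring)
theorem RC.ax2 {a b c : ℝ} {g : ℝ → ℝ → ℝ → ℝ} (h : RC a b c g) (x y z : ℝ)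
    (h0 : -1 ≤ y) (h1 : y ≤ 1) :
    g x y z ≤ (1 - (1 + y) / 2) * g x (-1) z + (1 + y) / 2 * g x 1 z :=
  h.seg x (-1) z x 1 z ((1 + y) / 2) (by linarith) (by linarith) (by ring) (by ring) (by ring)
    (by ring)
theorem RC.ax3 {a b c : ℝ} {g : ℝ → ℝ → ℝ → ℝ} (h : RC a b c g) (x y z : ℝ)
    (h0 : -1 ≤ z) (h1 : z ≤ 1) :
    g x y z ≤ (1 - (1 + z) / 2) * g x y (-1) + (1 + z) / 2 * g x y 1 :=
  h.seg x y (-1) x y 1 ((1 + z) / 2) (by linarith) (by linarith) (by ring) (by ring) (by ring)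
    (by ring)

theorem RC.tri {a b c : ℝ} {g : ℝ → ℝ → ℝ → ℝ} (h : RC a b c g) (x y z : ℝ)
    (hx0 : -1 ≤ x) (hx1 : x ≤ 1) (hy0 : -1 ≤ y) (hy1 : y ≤ 1) (hz0 : -1 ≤ z) (hz1 : z ≤ 1) :
    g x y z ≤ triW g x y z := by
  have e1 := h.ax1 x y z hx0 hx1
  have e2 : ∀ x, g x y z ≤ (1 - (1 + y) / 2) * ((1 - (1 + z) / 2) * g x (-1) (-1) + (1 + z) / 2 * g x (-1) 1)
     + (1 + y) / 2 * ((1 - (1 + z) / 2) * g x 1 (-1) + (1 + z) / 2 * g x 1 1) := by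
    intro x
    refine (h.ax2 x y z hy0 hy1).trans (add_le_add ?_ ?_)
    · exact mul_le_mul_of_nonneg_left (h.ax3 _ _ _ hz0 hz1) (by linarith)
    · exact mul_le_mul_of_nonneg_left (h.ax3 _ _ _ hz0 hz1) (by linarith)
  refine e1.trans ((add_le_add (mul_le_mul_of_nonneg_left (e2 (-1)) (by linarith))
    (mul_le_mul_of_nonneg_left (e2 1) (by linarith))).trans (le_of_eq ?_))
  unfold triW We Wx Wy Wz WA WB WC WX
  ring

/-- T_x laminate, general a = 1 -/
theorem RC.Tx {b c : ℝ} {g : ℝ → ℝ → ℝ → ℝ} (h : RC 1 b c g) (hb : 0 ≤ b) (hc : 0 ≤ c)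
    (hbc : b ≤ 1 + c) :
    (1 + 2 * c) * g 0 0 0 ≤ (1 + 2 * c) * We g + (c * WA g - b * WB g + (c - b) * WX g) + WX g := by
  obtain ⟨k, hk⟩ : ∃ k, k = b / (1 + c) := ⟨_, rfl⟩
  obtain ⟨z, hz⟩ : ∃ z, z = 1 / (1 + 2 * c) := ⟨_, rfl⟩
  have hk' : k * (1 + c) = b := by rw [hk]; field_simp
  have hz' : z * (1 + 2 * c) = 1 := by rw [hz]; field_simp
  have hk0 : 0 ≤ k := by rw [hk]; positivity
  have hk1 : k ≤ 1 := by rw [hk, div_le_one (by linarith)]; linarith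
  have hz0 : 0 ≤ z := by rw [hz]; positivity
  have hz1 : z ≤ 1 := by rw [hz, div_le_one (by linarith)]; linarith
  have e0 := h.seg (X := 0) (Y := 0) (Z := 0) (1 - k) 0 0 (-(1 - k)) 0 0 (1/2) (by norm_num) (by norm_num)
    (by ring) (by ring) (by ring) (by ring)
  have e1 := h.seg (X := 1 - k) (Y := 0) (Z := 0) 1 (-1) (-1) (1 - 2 * k) 1 1 (1/2) (by norm_num) (by norm_num)
    (by linear_combination (-4) * hk') (by ring) (by ring) (by ring)
  have e2 := h.seg (X := -(1 - k)) (Y := 0) (Z := 0) (-1) (-1) z (-1 + 2 * k) 1 (-z) (1/2) (by norm_num) (by norm_num)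
    (by rw [← hk']; linear_combination (-4 * k) * hz') (by ring) (by ring) (by ring)
  have f1 := h.tri 1 (-1) (-1) (by norm_num) (by norm_num) (by norm_num) (by norm_num) (by norm_num) (by norm_num)
  have f2 := h.tri (1 - 2 * k) 1 1 (by linarith) (by linarith) (by norm_num) (by norm_num) (by norm_num) (by norm_num)
  have f3 := h.tri (-1) (-1) z (by norm_num) (by norm_num) (by norm_num) (by norm_num) (by linarith) (by linarith)
  have f4 := h.tri (-1 + 2 * k) 1 (-z) (by linarith) (by linarith) (by norm_num) (by norm_num) (by linarith) (by linarith)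
  have key : g 0 0 0 ≤ (triW g 1 (-1) (-1) + triW g (1 - 2 * k) 1 1 + triW g (-1) (-1) z
    + triW g (-1 + 2 * k) 1 (-z)) / 4 := by linarith
  have := mul_le_mul_of_nonneg_left key (by linarith : 0 ≤ 1 + 2 * c)
  refine this.trans (le_of_eq ?_)
  unfold triW
  rw [← hk']
  have hzc : z * c = (1 - z) / 2 := by linarith
  linear_combination ((-WA g + (-k) * WB g + (1 - k) * WX g)/2 ) * hz'

theorem RC.G1 {b c : ℝ} {g : ℝ → ℝ → ℝ → ℝ} (h : RC 1 b c g) {k : ℝ}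
    (hk' : k * (1 + c) = b) (hk0 : 0 ≤ k) (hk1 : k ≤ 1) :
    g (1 - k) 0 0 ≤ We g + (1 - k) * Wx g + WA g - k * WB g - k * WC g + (1 - k) * WX g := by
  have e1 := h.seg (X := 1 - k) (Y := 0) (Z := 0) 1 (-1) (-1) (1 - 2 * k) 1 1 (1/2) (by norm_num) (by norm_num)
    (by linear_combination (-4) * hk') (by ring) (by ring) (by ring)
  have f1 := h.tri 1 (-1) (-1) (by norm_num) (by norm_num) (by norm_num) (by norm_num) (by norm_num) (by norm_num)
  have f2 := h.tri (1 - 2 * k) 1 1 (by linarith) (by linarith) (by norm_num) (by norm_num) (by norm_num) (by norm_num)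
  have : g (1 - k) 0 0 ≤ (triW g 1 (-1) (-1) + triW g (1 - 2 * k) 1 1) / 2 := by linarith
  refine this.trans (le_of_eq ?_)
  unfold triW
  ring

theorem RC.G2 {b c : ℝ} {g : ℝ → ℝ → ℝ → ℝ} (h : RC 1 b c g) {ζ r τ η θ : ℝ}
    (hr : r * (1 - c * ζ) = b * ζ) (hτ : τ = r * η) 
    (hη : b * (1 + ζ) * η = c * (1 - ζ)) (hθ : 2 * b * ζ * θ = 1 - ζ) (hb : 0 < b) 
    (hζ0 : 1 / 2 ≤ ζ) (hζ1 : ζ ≤ 1) (hr0 : 0 ≤ r) (hr1 : r ≤ 1)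
    (hη0 : 0 ≤ η) (hη1 : η ≤ 1) (hθ0 : 0 ≤ θ) (hθ1 : θ ≤ 1) :
    g (-(1 - r)) 0 0 ≤ (1 - τ) / 2 * triW g (-1) (-1) ζ + (1 + τ - r) / 2 * triW g (-1) 1 (-1)
      + r / 2 * triW g 1 (1 - 2 * η) (-1 + 2 * θ) := by
  have hτ0 : 0 ≤ τ := by rw [hτ]; positivity
  have hτ1 : τ ≤ 1 := by rw [hτ]; nlinarith
  obtain ⟨n, hn⟩ : ∃ n, n = 2 * r / (1 + τ) := ⟨_, rfl⟩
  have hn' : n * (1 + τ) = 2 * r := by rw [hn]; field_simp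
  have hn0 : 0 ≤ n := by rw [hn]; positivity
  have hn2 : n ≤ 2 := by rw [hn, div_le_iff₀ (by linarith)]; nlinarith
  -- θ r = ((1 - ζ)+ τ(1+ζ))/2
  have hm : 2 * r * θ = (1 - ζ) + τ * (1 + ζ) := by
    have hbz : b * ζ ≠ 0 := by positivity
    have : b * ζ * (2 * r * θ) = b * ζ * ((1 - ζ) + τ * (1 + ζ)) := by
      rw [hτ]
      linear_combination r * hθ + (1 - ζ) * hr - ζ * r * hη
    exact mul_left_cancel₀ hbz this
  have e1 := h.seg (X := -(1 - r)) (Y := 0) (Z := 0) (-1) (-1) ζ (-1 + n) (1 - η * n) (-1 + θ * n)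
    ((1 + τ) / 2) (by linarith) (by linarith) (by
      have h1t : (1 + τ) ^ 2 ≠ 0 := by positivity
      apply mul_left_cancel₀ h1t
      have a1 : (1 + τ) * (-1 - (-1 + n)) = - 2 * r := by linear_combination (-1) * hn'
      have a2 : (1 + τ) * (-1 - (1 - η * n)) = - 2 := by
        linear_combination η * hn' + (-2) * hτ 
      have a3 : (1 + τ) * (ζ - (-1 + θ * n)) = 2 * ζ := by
        linear_combination (-θ) * hn' - hm 
      calc _ = 1 * ((1 + τ) * (-1 - (-1 + n))) * ((1 + τ) * (-1 - (1 - η * n))) + 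
          b * ((1 + τ) * (-1 - (1 - η * n))) * ((1 + τ) * (ζ - (-1 + θ * n))) + 
          c * ((1 + τ) * (-1 - (-1 + n))) * ((1 + τ) * (ζ - (-1 + θ * n))) := by ring
        _ = 0 := by rw [a1, a2, a3]; linear_combination 4 * hr
        _ = _ := by ring) (by linear_combination (-1/2) * hn') (by linear_combination η / 2 * hn' - hτ) 
        (by linear_combination -θ / 2 * hn' - hm/2)
  have e2 := h.seg (X := -1 + n) (Y := 1 - η * n) (Z := -1 + θ * n) (-1) 1 (-1) 1 (1 - 2 * η) (-1 + 2 * θ) (n / 2) 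
    (by linarith) (by linarith) (by
      have hbz : b * ζ ≠ 0 := by positivity
      apply mul_left_cancel₀ hbz
      linear_combination (2 * c - 2 * b * η) * hθ  - 2* hη ) (by ring) (by ring) (by ring)
  have f1 := h.tri (-1) (-1) ζ (by norm_num) (by norm_num) (by norm_num) (by norm_num) (by linarith) (by linarith)
  have f2 := h.tri (-1) 1 (-1) (by norm_num) (by norm_num) (by norm_num) (by norm_num) (by linarith) (by linarith)
  have f3 := h.tri 1 (1 - 2 * η) (-1 + 2 * θ) (by norm_num) (by norm_num) (by linarith) (by linarith) (by linarith) (by linarith)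
  have k1 := mul_le_mul_of_nonneg_left f1 (by linarith : 0 ≤ (1 - τ) / 2)
  have hw2 : (1 + τ) / 2 * (1 - n / 2) = (1 + τ - r) / 2 := by linear_combination (-1/4) * hn'
  have hw3 : (1 + τ) / 2 * (n / 2) = r / 2 := by linear_combination (1/4) * hn'
  have k2 := mul_le_mul_of_nonneg_left f2 (by linarith : 0 ≤ (1 + τ - r) / 2)
  have k3 := mul_le_mul_of_nonneg_left f3 (by linarith : 0 ≤ r / 2)
  have k0 := mul_le_mul_of_nonneg_left e2 (by linarith : 0 ≤ (1 + τ) / 2)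
  have k4 : (1 + τ) / 2 * g (-1 + n) (1 - η * n) (-1 + θ * n) ≤ (1 + τ - r) / 2 * g (-1) 1 (-1) + r / 2 * g 1 (1 - 2 * η) (-1 + 2 * θ) := by
    rw [← hw2, ← hw3]; linarith
  linarith

/-- T'_x -/
theorem RC.Tp {b c ζ : ℝ} {g : ℝ → ℝ → ℝ → ℝ} (h : RC 1 b c g) (hb : 0 < b) (hc : 0 < c)
    (hb1 : b ≤ 1) (hc1 : c ≤ 1) (hζ0 : 1 / 2 ≤ ζ) (hζ1 : ζ ≤ 1) (hζb : 1 ≤ ζ * (1 + 2 * b))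
    (hbc : (b + c) * ζ ≤ 1)
    (hG : ζ ^ 2 * (b + 2 * c + 2 * c ^ 2) + ζ * (4 * b * c - 2 * c - 2 * c ^ 2) - b = 0) :
    2 * b * (1 + ζ - 2 * c * ζ) * g 0 0 0 ≤ 2 * b * (1 + ζ - 2 * c * ζ) * We g
      + (2 * b * ζ * (1 + ζ) - 2 * c * ζ * (1 - ζ) - (1 - ζ ^ 2))
        * (c * WA g - b * WB g + (c - b) * WX g)
      + 2 * b * (1 + ζ - 2 * c * ζ) * ζ * WX g := by
  have hd : 0 < 1 - c * ζ := by nlinarith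
  have hD : 0 < 1 + ζ - 2 * c * ζ := by nlinarith
  obtain ⟨k, hk⟩ : ∃ k, k = b / (1 + c) := ⟨_, rfl⟩
  obtain ⟨r, hr⟩ : ∃ r, r = b * ζ / (1 - c * ζ) := ⟨_, rfl⟩
  obtain ⟨η, hη⟩ : ∃ η, η = c * (1 - ζ) / (b * (1 + ζ)) := ⟨_, rfl⟩
  obtain ⟨θ, hθ⟩ : ∃ θ, θ = (1 - ζ) / (2 * b * ζ) := ⟨_, rfl⟩
  obtain ⟨τ, hτ⟩ : ∃ τ, τ = r * η := ⟨_, rfl⟩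
  have hη1' : c * (1 - ζ) ≤ b * (1 + ζ) := by
    have : 0 ≤ 2 * ζ * c * (1 + c) := by positivity
    nlinarith [mul_pos hb hc]
  have hn1 : 0 ≤ 1 - ζ := by linarith
  have hζp : 0 < ζ := by linarith
  have hk' : k * (1 + c) = b := by rw [hk]; field_simp
  have hr' : r * (1 - c * ζ) = b * ζ := by rw [hr]; exact div_mul_cancel₀ _ hd.ne'
  have hη' : b * (1 + ζ) * η = c * (1 - ζ) := by rw [hη]; field_simp
  have hθ' : 2 * b * ζ * θ = 1 - ζ := by rw [hθ]; field_simp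
  have hk0 : 0 ≤ k := by rw [hk]; positivity
  have hk1 : k ≤ 1 := by rw [hk, div_le_one (by linarith)]; linarith
  have hr0 : 0 ≤ r := by rw [hr]; positivity
  have hr1 : r ≤ 1 := by rw [hr, div_le_one (by linarith)]; linarith
  have hη0 : 0 ≤ η := by rw [hη]; positivity
  have hη1 : η ≤ 1 := by rw [hη, div_le_one (by positivity)]; linarith
  have hθ0 : 0 ≤ θ := by rw [hθ]; positivity
  have hθ1 : θ ≤ 1 := by rw [hθ, div_le_one (by positivity)]; linarith
  have g1 := h.G1 hk' hk0 hk1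
  have g2 := h.G2 hr' hτ hη' hθ' hb hζ0 hζ1 hr0 hr1 hη0 hη1 hθ0 hθ1
  have hτv : τ * ((1 - c * ζ) * (1 + ζ)) = c * ζ * (1 - ζ) := by
    linear_combination ((1 - c * ζ) * (1 + ζ)) * hτ + η * (1 + ζ) * hr' + ζ * hη'
  have hτD : (1 - τ) * ((1 - c * ζ) * (1 + ζ)) = 1 + ζ - 2 * c * ζ := by
    linear_combination (-1) * hτv
  have hτ0 : 0 ≤ τ := by rw [hτ]; positivity
  have hτ1 : τ < 1 := by
    have : 0 < (1 - c * ζ) * (1 + ζ) := by positivity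
    by_contra hh
    have := mul_nonneg (by linarith : 0 ≤ τ - 1) this.le
    linarith
  have hroot : r - k = 2 * τ * (1 - k) := by
    have h3 : (1 + c) * ((1 - c * ζ) * (1 + ζ)) ≠ 0 := by positivity
    apply mul_left_cancel₀ h3
    linear_combination (1 + c) * (1 + ζ) * hr' - (1 - c * ζ) * (1 + ζ) * hk' - 2 * (1 - k) * (1 + c) * hτv + 2 * c * ζ * (1 - ζ) * hk' + hG
  have hk1' : k < 1 := by rw [hk, div_lt_one (by linarith)]; linarith
  have hτh : 0 ≤ 1 - 2 * τ := by
    by_contra hh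
    have := mul_pos (by linarith : 0 < 2 * τ - 1) (by linarith : 0 < 1 - k)
    linarith
  obtain ⟨l, hl⟩ : ∃ l, l = 1 / (2 * (1 - τ)) := ⟨_, rfl⟩
  have hl' : l * (2 * (1 - τ)) = 1 := by rw [hl]; exact div_mul_cancel₀ _ (by linarith)
  have hl0 : 0 ≤ l := by rw [hl]; apply div_nonneg <;> linarith
  have hl1 : l ≤ 1 := by rw [hl, div_le_one (by linarith)]; linarith
  have e0 := h.seg (X := 0) (Y := 0) (Z := 0) (1 - k) 0 0 (-(1 - r)) 0 0 l hl0 hl1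
    (by ring) (by linear_combination (1 - k) * hl' - l * hroot ) (by ring) (by ring)
  obtain ⟨G2, hG2⟩ : ∃ G2, G2 = (1 - τ) / 2 * triW g (-1) (-1) ζ + (1 + τ - r) / 2 * triW g (-1) 1 (-1)
      + r / 2 * triW g 1 (1 - 2 * η) (-1 + 2 * θ) := ⟨_, rfl⟩
  rw [← hG2] at g2
  have hm : 2 * r * θ = (1 - ζ) + τ * (1 + ζ) := by
    have hbz : b * ζ ≠ 0 := by positivity
    have : b * ζ * (2 * r * θ) = b * ζ * ((1 - ζ) + τ * (1 + ζ)) := by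
      rw [hτ]
      linear_combination r * hθ' + (1 - ζ) * hr' - ζ * r * hη'
    exact mul_left_cancel₀ hbz this
  have hG2' : G2 = We g - (1 - r) * Wx g + (-ζ + τ * ζ + τ - 2 * τ * θ) * WA g
      + (1 - ζ - r + τ + τ * ζ) * WB g + (r - 2 * τ) * WC g + (1 + 2 * τ - r - 2 * τ * θ) * WX g := by
    rw [hG2]; unfold triW
    linear_combination (Wz g + WA g + WB g + WX g) / 2 * hm +
     (Wy g - WA g + WC g - WX g + 2 * θ * WA g + 2 * θ * WX g ) * hτ
  have f0 : 2 * (1 - τ) * g 0 0 0 ≤ (1 - 2 * τ) * g (1 - k) 0 0 + g (-(1 - r)) 0 0 := by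
    have := mul_le_mul_of_nonneg_left e0 (by linarith : 0 ≤ 2 * (1 - τ))
    refine this.trans (le_of_eq ?_)
    linear_combination (g (-(1 - r)) 0 0 - g (1 - k) 0 0) * hl'
  have f1 := mul_le_mul_of_nonneg_left g1 hτh
  have f2 : 2 * (1 - τ) * g 0 0 0 ≤ 2 * (1 - τ) * We g + (1 - ζ + τ * ζ - τ - 2 * τ * θ) * WA g
     + (1-ζ-2*r+3*τ+τ*ζ) * WB g + (2-2*r+2*τ-2*τ*θ) * WX g := by
    refine (f0.trans (add_le_add f1 g2)).trans (le_of_eq ?_)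
    rw [hG2']
    linear_combination (Wx g + WB g + WC g + WX g) * hroot
  have f3 := mul_le_mul_of_nonneg_left f2 (by positivity : 0 ≤ b * ((1 - c * ζ) * (1 + ζ)))
  have cB : ((1 - c * ζ) * (1 + ζ)) * (1-ζ-2*r+3*τ+τ*ζ) = 
    -(2 * b * ζ * (1 + ζ) - 2 * c * ζ * (1 - ζ) - (1 - ζ ^ 2)) := by
    linear_combination (-2 * (1 + ζ)) * hr' + (3 + ζ) * hτv
  have hθτ : b * ((1 - c * ζ) * (1 + ζ)) * (2 * τ * θ) = c * (1 - ζ) ^ 2 := by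
    have hbz : ζ ≠ 0 := by positivity
    apply mul_left_cancel₀ hbz
    linear_combination (2 * b * ζ * θ) * hτv + c * ζ * (1 - ζ) * hθ'
  have cA : b * ((1 - c * ζ) * (1 + ζ)) * (1 - ζ + τ * ζ - τ - 2 * τ * θ) = 
    (2 * b * ζ * (1 + ζ) - 2 * c * ζ * (1 - ζ) - (1 - ζ ^ 2)) * c := by
    linear_combination b * (ζ - 1) * hτv - hθτ - hG
  have cX : b * ((1 - c * ζ) * (1 + ζ)) * (2-2*r+2*τ-2*τ*θ) = 
    (2 * b * ζ * (1 + ζ) - 2 * c * ζ * (1 - ζ) - (1 - ζ ^ 2)) * (c - b) + 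
     2 * b * (1 + ζ - 2 * c * ζ) * ζ := by
    linear_combination b * 2 * hτv - 2 * b * (1 + ζ) * hr' - hθτ - hG
  refine (le_of_eq ?_).trans (f3.trans (le_of_eq ?_))
  · linear_combination (-2 * b * g 0 0 0) * hτD
  · linear_combination (2 * b * We g) * hτD + WA g * cA + b * WB g * cB + WX g * cX

theorem aux1 {d c : ℝ} (hc : 0 < c) (hd : 0 ≤ d) (hb1 : c + d ≤ 1) (hbc : 1 < c + d + c)
    (hΘ : 4 * (c+d) * c < (1 + (c+d) + c) * (1 - (c + d - c) ^ 2)) 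
    (hh : 2 * c ^ 2 + 2 * c + 3 * (c+d) < 8 * (c+d) * c) : False := by
  rcases le_total (3/4) c with h | h
  · have e1 : 0 ≤ (1 - d) * (4 * c / 3 - 1) := mul_nonneg (by linarith) (by linarith)
    have e2 : 0 ≤ d ^ 2 * (1 + 2 * c + d) := by positivity
    nlinarith
  · have hc6 : 0.6 ≤ c := by
      by_contra h6
      push Not at h6
      rcases le_total c (3/8) with h3 | h3 <;>
      nlinarith
    have hd1 : 1/8 ≤ d := by nlinarith
    have hd2 : 0 ≤ (1 - d) * (4 * c / 3 - 1) + d^2 * (1 + 2 * c + d) := by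
      nlinarith
    nlinarith


theorem aux2 {s : ℝ} (h : 0 ≤ s) (h2 : s ≤ 1/2) : 0 ≤ -8 * (1 / 2 + s) ^ 3 * 0.92 ^ 3 - 8 * (1 / 2 + s) * (1 - (1 / 2 + s)) ^ 2 * 0.92 ^ 2 +
      0.92 *
        (2 * (1 + (1 / 2 + s)) * (1 - (1 / 2 + s) ^ 2) - 6 * (1 / 2 + s) * (1 - (1 / 2 + s) ^ 2) +
          4 * (1 / 2 + s) * (1 + (1 / 2 + s))) -
    (1 + (1 / 2 + s)) * (1 - (1 / 2 + s) ^ 2) := by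
  nlinarith [mul_nonneg h (by linarith : 0 ≤ 1/2 - s), mul_nonneg (mul_nonneg h h) (by linarith : 0 ≤ 1/2 - s),mul_nonneg (mul_nonneg h h) h]

theorem aux3 {s : ℝ} (h : 0.53 ≤ s) (h2 : s ≤ 1) : 0 ≤ -8 * s ^ 3 * 0.95 ^ 3 - 8 * s * (1 - s) ^ 2 * 0.95 ^ 2 +
      0.95 *
        (2 * (1 + s) * (1 - s ^ 2) - 6 * s * (1 - s ^ 2) +
          4 * s * (1 + s)) -
    (1 + s) * (1 - s ^ 2) := by
  have a : 0 ≤ s - 0.53 := by linarith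
  have a2 : 0 ≤ 1 - s := by linarith
  nlinarith [mul_nonneg a a2, mul_nonneg (mul_nonneg a a) a2, mul_nonneg (mul_nonneg a a) a]

theorem aux4 {b c : ℝ} (hcb : c ≤ b) (hb1 : b ≤ 0.95) (h9 : 0.92 ≤ b) (hc : 0.7 < c) 
  (hΘ : 4 * b * c < (1 + b + c) * (1 - (b - c) ^ 2)) : False := by
  have a : 0 ≤ c - 0.7 := by linarith
  have a2 : 0 ≤ b - 0.92 := by linarith
  have a3 : 0 ≤ 0.95 - b := by linarith
  have a4 : 0 ≤ b - c := by linarith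
  nlinarith [mul_nonneg a a2, mul_nonneg a a4, mul_nonneg a2 a3, mul_nonneg a a3, mul_nonneg a4 (mul_nonneg a a4)]

theorem aux5 {b c : ℝ} (hcb : c ≤ b) (hb1 : b ≤ 1) (h9 : 0.95 ≤ b) (hc : 0.6 < c) 
  (hΘ : 4 * b * c < (1 + b + c) * (1 - (b - c) ^ 2)) : False := by
  have a : 0 ≤ c - 0.6 := by linarith
  have a2 : 0 ≤ b - 0.95 := by linarith
  have a3 : 0 ≤ 1 - b := by linarith
  have a4 : 0 ≤ b - c := by linarith
  nlinarith [mul_nonneg a a2, mul_nonneg a a4, mul_nonneg a2 a3, mul_nonneg a a3, mul_nonneg a4 (mul_nonneg a a4)]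

theorem RC.swap {a b c : ℝ} {g : ℝ → ℝ → ℝ → ℝ} (h : RC a b c g) :
    RC a c b (fun x y z => g y x z) := by
  intro x y z x' y' z' l h0 h1 hn
  exact h y x z y' x' z' l h0 h1 (by linarith)

theorem We_swap (g : ℝ → ℝ → ℝ → ℝ) : We (fun x y z => g y x z) = We g := by unfold We; ring
theorem WX_swap (g : ℝ → ℝ → ℝ → ℝ) : WX (fun x y z => g y x z) = WX g := by unfold WX; ring
theorem WA_swap (g : ℝ → ℝ → ℝ → ℝ) : WA (fun x y z => g y x z) = WB g := by unfold WA WB; ring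
theorem WB_swap (g : ℝ → ℝ → ℝ → ℝ) : WB (fun x y z => g y x z) = WA g := by unfold WA WB; ring

theorem RC.Ty {b c : ℝ} {g : ℝ → ℝ → ℝ → ℝ} (h : RC 1 b c g) (hb : 0 ≤ b) (hc : 0 ≤ c)
    (hbc : c ≤ 1 + b) :
    (1 + 2 * b) * g 0 0 0 ≤ (1 + 2 * b) * We g - (c * WA g - b * WB g + (c - b) * WX g) + WX g := by
  have := h.swap.Tx hc hb hbc
  simp only [We_swap, WX_swap, WA_swap, WB_swap] at this
  linarith

theorem RC.Tpy {b c ζ : ℝ} {g : ℝ → ℝ → ℝ → ℝ} (h : RC 1 b c g) (hb : 0 < b) (hc : 0 < c)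
    (hb1 : b ≤ 1) (hc1 : c ≤ 1) (hζ0 : 1 / 2 ≤ ζ) (hζ1 : ζ ≤ 1) (hζb : 1 ≤ ζ * (1 + 2 * c))
    (hbc : (c + b) * ζ ≤ 1)
    (hG : ζ ^ 2 * (c + 2 * b + 2 * b ^ 2) + ζ * (4 * c * b - 2 * b - 2 * b ^ 2) - c = 0) :
    2 * c * (1 + ζ - 2 * b * ζ) * g 0 0 0 ≤ 2 * c * (1 + ζ - 2 * b * ζ) * We g
      - (2 * c * ζ * (1 + ζ) - 2 * b * ζ * (1 - ζ) - (1 - ζ ^ 2))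
        * (c * WA g - b * WB g + (c - b) * WX g)
      + 2 * c * (1 + ζ - 2 * b * ζ) * ζ * WX g := by
  have := h.swap.Tp hc hb hc1 hb1 hζ0 hζ1 hζb hbc hG
  simp only [We_swap, WX_swap, WA_swap, WB_swap] at this
  linarith

theorem case1 {b c : ℝ} {g : ℝ → ℝ → ℝ → ℝ} (h : RC 1 b c g) (hb : 0 ≤ b) (hc : 0 ≤ c)
    (hbc : b + c ≤ 1) (hX : WX g ≤ 0) : g 0 0 0 ≤ We g + WX g / 2 := by
  have h1 := h.Tx hb hc (by linarith)
  have h2 := h.Ty hb hc (by linarith)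
  by_contra hh
  push Not at hh
  have := mul_lt_mul_of_pos_left hh (by linarith : 0 < 2 + 2 * b + 2 * c)
  nlinarith

theorem root_ge {b c ζ m : ℝ} (hb : 0 < b) (hc : 0 < c) (hζ : 0 ≤ ζ)
    (hG : ζ ^ 2 * (b + 2 * c + 2 * c ^ 2) + ζ * (4 * b * c - 2 * c - 2 * c ^ 2) - b = 0)
    (hm : m ^ 2 * (b + 2 * c + 2 * c ^ 2) + m * (4 * b * c - 2 * c - 2 * c ^ 2) - b ≤ 0) :
    m ≤ ζ := by
  by_contra hh
  push Not at hh
  have h1 : 0 < (m - ζ) * (ζ * m * (b + 2 * c + 2 * c ^ 2) + b) := by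
    apply mul_pos (by linarith)
    have : 0 ≤ m := by linarith
    positivity
  have h2 := mul_nonpos_of_nonneg_of_nonpos hζ hm
  have h3 : m * (ζ ^ 2 * (b + 2 * c + 2 * c ^ 2) + ζ * (4 * b * c - 2 * c - 2 * c ^ 2) - b) = 0 := by
    rw [hG, mul_zero]
  nlinarith

theorem root_exists {b c : ℝ} (hb : 0 < b) (hc : 0 < c) (hb1 : b ≤ 1) (hc1 : c ≤ 1)
    (hbc : 1 < b + c) (hcond : 8 * b * c ≤ 2 * c ^ 2 + 2 * c + 3 * b) :
    ∃ ζ : ℝ, 1 / 2 ≤ ζ ∧ ζ ≤ 1 ∧ 1 ≤ ζ * (1 + 2 * b) ∧ (b + c) * ζ ≤ 1 ∧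
      ζ ^ 2 * (b + 2 * c + 2 * c ^ 2) + ζ * (4 * b * c - 2 * c - 2 * c ^ 2) - b = 0 := by
  have hs : 0 < b + c := by linarith
  have hcont : ContinuousOn (fun ζ : ℝ => ζ ^ 2 * (b + 2 * c + 2 * c ^ 2) + ζ * (4 * b * c - 2 * c - 2 * c ^ 2) - b)
    (Set.Icc 0 (1 / (b + c))) := by fun_prop
  have hI := intermediate_value_Icc (by positivity : (0:ℝ) ≤ 1 / (b + c)) hcont
  have h0 : (0:ℝ) ∈ Set.Icc ((fun ζ : ℝ => ζ ^ 2 * (b + 2 * c + 2 * c ^ 2) + ζ * (4 * b * c - 2 * c - 2 * c ^ 2) - b) 0)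
     ((fun ζ : ℝ => ζ ^ 2 * (b + 2 * c + 2 * c ^ 2) + ζ * (4 * b * c - 2 * c - 2 * c ^ 2) - b) (1 / (b + c))) := by
    constructor
    · simp only []; nlinarith
    · simp only []
      have : (1 / (b + c)) ^ 2 * (b + 2 * c + 2 * c ^ 2) + (1 / (b + c)) * (4 * b * c - 2 * c - 2 * c ^ 2) - b
         = ((1-b)*(b+b^2-2*b*c)+2*c*(1-c^2)+b*c^2) / (b + c) ^ 2 := by
        field_simp; ring
      rw [this]
      apply div_nonneg _ (by positivity)
      have e1 : 0 ≤ b * (1 - b) * (1 - c) := mul_nonneg (mul_nonneg hb.le (by linarith)) (by linarith)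
      have e2 : 0 ≤ b * ((c - (1 - b)) * (c + (1 - b))) := mul_nonneg hb.le (mul_nonneg (by linarith) (by linarith))
      have e3 : 0 ≤ c * ((1 - c) * (1 + c)) := mul_nonneg hc.le (mul_nonneg (by linarith) (by linarith))
      nlinarith
  obtain ⟨ζ, hζ, hG⟩ := hI h0
  simp only [] at hG
  have hz0 : 0 ≤ ζ := hζ.1
  have hz1 : (b + c) * ζ ≤ 1 := by
    have := hζ.2
    rw [le_div_iff₀ hs] at this; linarith
  have e1 : 1 / 2 ≤ ζ := root_ge hb hc hz0 hG (by nlinarith)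
  have e2 : 1 / (1 + 2 * b) ≤ ζ := root_ge hb hc hz0 hG (by
    have : (1 / (1 + 2 * b)) ^ 2 * (b + 2 * c + 2 * c ^ 2) + (1 / (1 + 2 * b)) * (4 * b * c - 2 * c - 2 * c ^ 2) - b
         = - (4 * b * ((b - c) ^ 2 + b)) / (1 + 2 * b) ^ 2 := by
        field_simp; ring
    rw [this]
    apply div_nonpos_of_nonpos_of_nonneg _ (by positivity)
    have : 0 ≤ 4 * b * ((b - c) ^ 2 + b) := by positivity
    linarith)
  refine ⟨ζ, e1, by nlinarith, ?_, hz1, hG⟩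
  rw [div_le_iff₀ (by linarith)] at e2; exact e2

theorem N_nonneg {b c ζ : ℝ} (hc : 0 < c) (hcb : c ≤ b) (hb1 : b ≤ 1) (h1 : 1 / 2 ≤ ζ) (h2 : ζ ≤ 1)
    (hG : ζ ^ 2 * (b + 2 * c + 2 * c ^ 2) + ζ * (4 * b * c - 2 * c - 2 * c ^ 2) - b = 0) :
    0 ≤ 2 * b * ζ * (1 + ζ) - 2 * c * ζ * (1 - ζ) - (1 - ζ ^ 2) := by
  have hb : 0 < b := by linarith
  have e : b * (2 * b * ζ * (1 + ζ) - 2 * c * ζ * (1 - ζ) - (1 - ζ ^ 2)) =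
    2 * ζ * (ζ*(b^2+b*c-c-c^2)+(b^2-3*b*c+c+c^2)) := by linear_combination hG
  have p : 0 ≤ 2 * ζ * (ζ*(b^2+b*c-c-c^2)+(b^2-3*b*c+c+c^2)) := by
    apply mul_nonneg (by linarith)
    have e1 : 0 ≤ (2 * ζ - 1) * (2 * b * (b - c)) := mul_nonneg (by linarith) (mul_nonneg (by linarith) (by linarith))
    have e2 : 0 ≤ (1 - ζ) * ((3 * b - c) * (b - c) + c * (1 - b)) := mul_nonneg (by linarith) (add_nonneg (mul_nonneg (by linarith) (by linarith)) (mul_nonneg (by linarith) (by linarith)))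
    nlinarith
  rw [← e] at p
  exact nonneg_of_mul_nonneg_right p hb

theorem cond_of_not {b c : ℝ} (hc : 0 < c) (hcb : c ≤ b) (hb1 : b ≤ 1) (hbc : 1 < b + c)
    (hΘ : 4 * b * c < (1 + b + c) * (1 - (b - c) ^ 2)) :
    8 * b * c ≤ 2 * c ^ 2 + 2 * c + 3 * b := by
  by_contra hh
  push Not at hh
  obtain ⟨d, rfl⟩ : ∃ d, b = c + d := ⟨b - c, by ring⟩
  exact aux1 hc (by linarith) hb1 hbc hΘ hh

noncomputable def KK (b ζ : ℝ) : ℝ := -8*ζ^3*b^3 -8*ζ*(1-ζ)^2*b^2 + b*(2*(1+ζ)*(1-ζ^2)-6*ζ*(1-ζ^2)+4*ζ*(1+ζ)) - (1+ζ)*(1-ζ^2)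

theorem KK_interp (q b ζ : ℝ) (h1 : 1 / 2 ≤ ζ) (h2 : ζ ≤ 1) (hb : 1 / 2 ≤ b) (hbq : b ≤ q) (hq : 1 / 2 < q)
    (hK : 0 ≤ KK q ζ) : 0 ≤ KK b ζ := by
  have e : (q - 1/2) * KK b ζ = (q - b) * (3 * ζ * (2 * ζ - 1)) + (b - 1/2) * KK q ζ +
    (q-1/2)*(b-1/2)*(q-b)*(8*ζ^3*(b+1/2+q)+8*ζ*(1-ζ)^2) := by unfold KK; ring
  have : 0 ≤ (q - 1/2) * KK b ζ := by
    rw [e]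
    have a1 : 0 ≤ q - b := by linarith
    have a2 : 0 ≤ b - 1/2 := by linarith
    have a3 : 0 ≤ q - 1/2 := by linarith
    have a4 : 0 ≤ 2 * ζ - 1 := by linarith
    have a5 : 0 ≤ ζ := by linarith
    have a6 : 0 ≤ b := by linarith
    have a7 : 0 ≤ q := by linarith
    positivity
  exact nonneg_of_mul_nonneg_right this (by linarith)

theorem KK_nonneg {b c ζ : ℝ} (hc : 0 < c) (hcb : c ≤ b) (hb1 : b ≤ 1) (hbc : 1 < b + c)
    (hΘ : 4 * b * c < (1 + b + c) * (1 - (b - c) ^ 2)) (h1 : 1 / 2 ≤ ζ) (h2 : ζ ≤ 1)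
    (hG : ζ ^ 2 * (c + 2 * b + 2 * b ^ 2) + ζ * (4 * c * b - 2 * b - 2 * b ^ 2) - c = 0) :
    0 ≤ KK b ζ := by
  have hb : 0 < b := by linarith
  rcases le_total b 0.92 with h | h
  · apply KK_interp 0.92 b ζ h1 h2 (by linarith) h (by norm_num)
    unfold KK
    obtain ⟨s, rfl⟩ : ∃ s, ζ = 1/2 + s := ⟨ζ - 1/2, by ring⟩
    exact aux2 (by linarith) (by linarith)
  rcases le_total b 0.95 with h' | h'
  · have hc7 : c ≤ 0.7 := by
      by_contra hh
      push Not at hh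
      exact aux4 hcb h' h hh hΘ
    have hz : 0.53 ≤ ζ := root_ge hc hb (by linarith) hG (by nlinarith [sq_nonneg (b - 0.9858/(2*0.4982))])
    apply KK_interp 0.95 b ζ h1 h2 (by linarith) h' (by norm_num)
    unfold KK
    exact aux3 hz h2
  · have hc7 : c ≤ 0.6 := by
      by_contra hh
      push Not at hh
      exact aux5 hcb hb1 h' hh hΘ
    have hz : 4/7 ≤ ζ := root_ge hc hb (by linarith) hG (by nlinarith [sq_nonneg (b - 0.9)])
    apply KK_interp 1 b ζ h1 h2 (by linarith) hb1 (by norm_num)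
    have : KK 1 ζ = (1 - ζ) * (11*ζ^2-8*ζ+1) := by unfold KK; ring
    rw [this]
    apply mul_nonneg (by linarith)
    nlinarith

theorem Tcase {b c : ℝ} {g : ℝ → ℝ → ℝ → ℝ} (h : RC 1 b c g) (hc : 0 < c) (hcb : c ≤ b) (hb1 : b ≤ 1) (hbc : 1 < b + c)
    (hΘ : 4 * b * c < (1 + b + c) * (1 - (b - c) ^ 2)) (hX : WX g ≤ 0) :
    g 0 0 0 ≤ We g + WX g / 2 := by
  have hb : 0 < b := by linarith
  have hcond := cond_of_not hc hcb hb1 hbc hΘ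
  rcases le_total (c * WA g - b * WB g + (c - b) * WX g) 0 with hY | hY
  · obtain ⟨ζ, z1, z2, z3, z4, hG⟩ := root_exists hb hc hb1 (by linarith) hbc hcond
    have hT := h.Tp hb hc hb1 (by linarith) z1 z2 z3 z4 hG
    have hN := N_nonneg hc hcb hb1 z1 z2 hG
    have e1 := mul_nonpos_of_nonneg_of_nonpos hN hY
    have hD : 0 < 2 * b * (1 + ζ - 2 * c * ζ) := by
      have : 0 < 1 + ζ - 2 * c * ζ := by nlinarith
      positivity
    have e2 : 2 * b * (1 + ζ - 2 * c * ζ) * (ζ * WX g) ≤ 2 * b * (1 + ζ - 2 * c * ζ) * (WX g / 2) :=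
      mul_le_mul_of_nonneg_left (by nlinarith) hD.le
    exact le_of_mul_le_mul_left (by linarith) hD
  · obtain ⟨ζ, z1, z2, z3, z4, hG⟩ := root_exists hc hb (by linarith) hb1 (by linarith)
      (by nlinarith : 8 * c * b ≤ 2 * b ^ 2 + 2 * b + 3 * c)
    have hT := h.Tpy hb hc hb1 (by linarith) z1 z2 z3 z4 hG
    have hD : 0 < 2 * c * (1 + ζ - 2 * b * ζ) := by
      have : 0 < 1 + ζ - 2 * b * ζ := by
        by_contra hh
        have : (c + b) * ζ ≤ 1 := z4
        nlinarith [mul_pos hc (by linarith : 0 < ζ)]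
      positivity
    have e2 : 2 * c * (1 + ζ - 2 * b * ζ) * (ζ * WX g) ≤ 2 * c * (1 + ζ - 2 * b * ζ) * (WX g / 2) :=
      mul_le_mul_of_nonneg_left (by nlinarith) hD.le
    rcases le_total 0 (2 * c * ζ * (1 + ζ) - 2 * b * ζ * (1 - ζ) - (1 - ζ ^ 2)) with hN | hN
    · have e1 := mul_nonneg hN hY
      exact le_of_mul_le_mul_left (by linarith) hD
    · have hTy := h.Ty hb.le hc.le (by linarith)
      have hK := KK_nonneg hc hcb hb1 hbc hΘ z1 z2 hG
      obtain ⟨N, hNN⟩ : ∃ N, N = -(2 * c * ζ * (1 + ζ) - 2 * b * ζ * (1 - ζ) - (1 - ζ ^ 2)) := ⟨_, rfl⟩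
      obtain ⟨D, hDD⟩ : ∃ D, D = 2 * c * (1 + ζ - 2 * b * ζ) := ⟨_, rfl⟩
      have hN0 : 0 ≤ N := by linarith
      have hH : 0 ≤ (2 * ζ - 1) * D - (2 * b - 1) * N := by
        have hM : 0 < 4 * b * ζ - (1 - ζ ^ 2) := by nlinarith
        have : (4 * b * ζ - (1 - ζ ^ 2)) * ((2 * ζ - 1) * D - (2 * b - 1) * N) = (1 - ζ) * KK b ζ := by
          rw [hNN, hDD]; unfold KK
          linear_combination (2*((2*ζ-1)*(1+ζ-2*b*ζ)+(2*b-1)*ζ*(1+ζ))) * hG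
        have h3 : 0 ≤ (4 * b * ζ - (1 - ζ ^ 2)) * ((2 * ζ - 1) * D - (2 * b - 1) * N) := by
          rw [this]; exact mul_nonneg (by linarith) hK
        exact nonneg_of_mul_nonneg_right h3 hM
      have k1 := mul_le_mul_of_nonneg_left hTy hN0
      have hT' : D * g 0 0 0 ≤ D * We g + N * (c * WA g - b * WB g + (c - b) * WX g) + D * ζ * WX g := by
        rw [hNN, hDD]; linarith
      have hD0 : 0 < D := by rw [hDD]; exact hD
      have hpos : 0 < D + N * (1 + 2 * b) := by positivity
      refine le_of_mul_le_mul_left ?_ hpos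
      have k2 := mul_nonneg hH (by linarith : 0 ≤ - WX g)
      linarith

theorem RC.face {a b c : ℝ} {h : ℝ → ℝ → ℝ → ℝ} (H : RC a b c h) {q1 q2 q3 w0 w1 w3 wQ p1 p2 p3 : ℝ}
    (h0 : 0 ≤ w0) (h1 : 0 ≤ w1) (h3 : 0 ≤ w3) (hQ : 0 < wQ) (hsum : w0 + w1 + w3 + wQ = 1)
    (hq : a * q1 * q2 + b * q2 * (q3 - 1) + c * q1 * (q3 - 1) = 0)
    (hp1 : p1 = w1 + wQ * q1) (hp2 : p2 = wQ * q2) (hp3 : p3 = w3 + wQ * q3)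
    (hD : a * p1 * p2 + b * p2 * p3 + c * p1 * p3 = wQ * (a * q1 * q2 + b * q2 * q3 + c * q1 * q3)) :
    h p1 p2 p3 ≤ w0 * h 0 0 0 + w1 * h 1 0 0 + w3 * h 0 0 1 + wQ * h q1 q2 q3 := by
  have hl : 0 < w3 + wQ := by linarith
  obtain ⟨l, hl'⟩ : ∃ l, l = w3 + wQ := ⟨_, rfl⟩
  rw [← hl'] at hl
  obtain ⟨s, hs'⟩ : ∃ s, s = w0 + w1 := ⟨_, rfl⟩
  have hs0 : 0 ≤ s := by linarith
  have hsl : s = 1 - l := by linarith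
  obtain ⟨B1, hB1⟩ : ∃ B1, B1 = wQ * q1 / l := ⟨_, rfl⟩
  obtain ⟨B2, hB2⟩ : ∃ B2, B2 = wQ * q2 / l := ⟨_, rfl⟩
  obtain ⟨B3, hB3⟩ : ∃ B3, B3 = (w3 + wQ * q3) / l := ⟨_, rfl⟩
  obtain ⟨m, hm⟩ : ∃ m, m = wQ / l := ⟨_, rfl⟩
  have hm' : l * m = wQ := by rw [hm]; field_simp
  have hm3 : l * (1 - m) = w3 := by linarith
  have hm0 : 0 ≤ m := by rw [hm]; positivity
  have hm1 : m ≤ 1 := by rw [hm, div_le_one hl]; linarith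
  have lB1 : l * B1 = wQ * q1 := by rw [hB1]; field_simp
  have lB2 : l * B2 = wQ * q2 := by rw [hB2]; field_simp
  have lB3 : l * B3 = w3 + wQ * q3 := by rw [hB3]; field_simp
  have eB := H.seg (X := B1) (Y := B2) (Z := B3) 0 0 1 q1 q2 q3 m hm0 hm1 (by linarith)
    (by apply mul_left_cancel₀ hl.ne'; rw [lB1]; linear_combination -q1 * hm')
    (by apply mul_left_cancel₀ hl.ne'; rw [lB2]; linear_combination -q2 * hm')
    (by apply mul_left_cancel₀ hl.ne'; rw [lB3]; linear_combination -hm3 -q3 * hm')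
  have eB' : l * h B1 B2 B3 ≤ w3 * h 0 0 1 + wQ * h q1 q2 q3 := by
    rw [← hm3, ← hm']
    have := mul_le_mul_of_nonneg_left eB hl.le
    linarith
  have hDB : l * (a * B1 * B2 + b * B2 * B3 + c * B1 * B3) = wQ * (a * q1 * q2 + b * q2 * q3 + c * q1 * q3) := by
    apply mul_left_cancel₀ hl.ne'
    calc l * (l * (a * B1 * B2 + b * B2 * B3 + c * B1 * B3)) = a * (l * B1) * (l * B2) + b * (l * B2) * (l * B3) + c * (l * B1) * (l * B3) := by ring
      _ = l * (wQ * (a * q1 * q2 + b * q2 * q3 + c * q1 * q3)) := by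
        rw [lB1, lB2, lB3, hl']
        linear_combination -(wQ * w3) * hq
  rcases hs0.eq_or_lt with hs | hs
  · have hw0 : w0 = 0 := by linarith
    have hw1 : w1 = 0 := by linarith
    have l1 : l = 1 := by linarith
    have e1 : p1 = B1 := by rw [hp1, hw1, ← lB1, l1]; ring
    have e2 : p2 = B2 := by rw [hp2, ← lB2, l1]; ring
    have e3 : p3 = B3 := by rw [hp3, ← lB3, l1]; ring
    rw [e1, e2, e3, hw0, hw1]
    rw [l1] at eB'
    linarith
  · obtain ⟨α, hα⟩ : ∃ α, α = w1 / s := ⟨_, rfl⟩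
    have hα' : s * α = w1 := by rw [hα]; field_simp
    have hα0 : 0 ≤ α := by rw [hα]; positivity
    have hα1 : α ≤ 1 := by rw [hα, div_le_one hs]; linarith
    have eA := H.seg (X := α) (Y := 0) (Z := 0) 0 0 0 1 0 0 α hα0 hα1 (by ring) (by ring) (by ring) (by ring)
    have eA' := mul_le_mul_of_nonneg_left eA hs.le
    have e := H.seg (X := p1) (Y := p2) (Z := p3) α 0 0 B1 B2 B3 l hl.le (by linarith) (by
      have hsl' : l * s ≠ 0 := by positivity
      apply mul_left_cancel₀ hsl'
      have k1 : p1 = s * α + l * B1 := by rw [hp1, hα', lB1]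
      have k2 : p2 = l * B2 := by rw [hp2, lB2]
      have k3 : p3 = l * B3 := by rw [hp3, lB3]
      rw [k1, k2, k3, ← hDB] at hD
      rw [hsl] at hD ⊢
      linear_combination -hD) (by rw [hp1, ← hsl, hα', lB1]) (by rw [hp2, lB2]; ring) (by rw [hp3, lB3]; ring)
    rw [← hsl] at e
    have : s * ((1 - α) * h 0 0 0 + α * h 1 0 0) = w0 * h 0 0 0 + w1 * h 1 0 0 := by
      linear_combination (h 1 0 0 - h 0 0 0) * hα' + h 0 0 0 * hs' 
    linarith

theorem RC.swapyz {a b c : ℝ} {g : ℝ → ℝ → ℝ → ℝ} (h : RC a b c g) :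
    RC c b a (fun x y z => g x z y) := by
  intro x y z x' y' z' l h0 h1 hn
  exact h x z y x' z' y' l h0 h1 (by linarith)

theorem RC.center {u v w : ℝ} {h : ℝ → ℝ → ℝ → ℝ} (H : RC (v + w) (u + w) (u + v) h)
    (hu : 0 < u) (hv : 0 < v) (hw : 0 < w) (hvw : v ≤ w) :
    2 * ((u + v) * (v + w) * (w + u)) * h (1/2) (1/2) (1/2) ≤
      u * v * w * h 0 0 0 + u * w * (u + w) * h 1 0 0 + u * v * (u + v) * h 0 1 0 + v * w * (v + w) * h 0 0 1
       + (u + v + w) * ((u * v + v * w + w * u) * h (v * (u + w) / (u * v + v * w + w * u)) (w * (u + v) / (u * v + v * w + w * u))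
          (u * (v + w) / (u * v + v * w + w * u))) := by
  have hΔ : 0 < u * v + v * w + w * u := by positivity
  have hvw' : 0 ≤ w - v := by linarith
  have up := H.face (q1 := v * (u + w) / (u * v + v * w + w * u)) (q2 := w * (u + v) / (u * v + v * w + w * u))
          (q3 := u * (v + w) / (u * v + v * w + w * u)) (w0 := u*v*(w-v)/(2*(u+v)*w*(2*u+v+w)))
     (w1 := u*(w-v)/(2*w*(u+v))) (w3 := v*(v+w)*(u+w)/(2*(u+v)*w*(2*u+v+w))) (wQ := (u * v + v * w + w * u)/(2*w*(u+v)))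
     (p1 := 1/2) (p2 := 1/2) (p3 := 1/2 + u * v / (w * (2*u+v+w)))
     (by positivity) (by positivity) (by positivity) (by positivity) (by field_simp; ring) (by field_simp; ring) (by field_simp; ring)
     (by field_simp) (by field_simp; ring) (by field_simp; ring)
  have dn := H.swapyz.face (q1 := v * (u + w) / (u * v + v * w + w * u)) (q3 := w * (u + v) / (u * v + v * w + w * u))
          (q2 := u * (v + w) / (u * v + v * w + w * u)) (w0 := v * w/(2*(u*v+u*w+2*v*w)))
     (w1 := w*(u+v)/(2*(u*v+u*w+2*v*w))) (w3 := v*(u+w)/(2*(u*v+u*w+2*v*w))) (wQ := (u * v + v * w + w * u)/(2*(u*v+u*w+2*v*w)))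
     (p1 := 1/2) (p3 := 1/2) (p2 := 1/2 - v * w / (u*v+u*w+2*v*w))
     (by positivity) (by positivity) (by positivity) (by positivity) (by field_simp; ring) (by field_simp; ring) (by field_simp; ring)
     (by field_simp; ring) (by field_simp; ring) (by field_simp; ring)
  have mid := H.seg (X := 1/2) (Y := 1/2) (Z := 1/2) (1/2) (1/2) (1/2 + u * v / (w * (2*u+v+w)))
     (1/2) (1/2) (1/2 - v * w / (u*v+u*w+2*v*w)) (u*(u*v+u*w+2*v*w)/((v+w)*(u+w)^2)) (by positivity)
     (by rw [div_le_one (by positivity)]; nlinarith [mul_pos hu hv, mul_pos hv hw, mul_pos hu hw, mul_pos hw (mul_pos hw hw), mul_pos hw (mul_pos hu hw), mul_pos hw (mul_pos hv hw)]) (by ring) (by ring) (by ring) (by field_simp; ring)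
  have e1 : 1 - u*(u*v+u*w+2*v*w)/((v+w)*(u+w)^2) = w^2*(2*u+v+w)/((v+w)*(u+w)^2) := by field_simp; ring
  rw [e1] at mid
  have m1 := mul_le_mul_of_nonneg_left up (by positivity : 0 ≤ w^2*(2*u+v+w)/((v+w)*(u+w)^2))
  have m2 := mul_le_mul_of_nonneg_left dn (by positivity : 0 ≤ u*(u*v+u*w+2*v*w)/((v+w)*(u+w)^2))
  have m3 := mul_le_mul_of_nonneg_left (mid.trans (add_le_add m1 m2)) (by positivity : 0 ≤ 2 * ((u + v) * (v + w) * (w + u)))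
  refine m3.trans (le_of_eq ?_)
  generalize h (v * (u + w) / (u * v + v * w + w * u)) (w * (u + v) / (u * v + v * w + w * u))
          (u * (v + w) / (u * v + v * w + w * u)) = hQ
  generalize h 0 0 0 = t0
  generalize h 1 0 0 = t1
  generalize h 0 1 0 = t2
  generalize h 0 0 1 = t3
  field_simp
  ring

theorem RC.aff {a b c : ℝ} {g : ℝ → ℝ → ℝ → ℝ} (h : RC a b c g) :
    RC a b c (fun x y z => g (2 * x - 1) (2 * y - 1) (2 * z - 1)) := by
  intro x y z x' y' z' l h0 h1 hn
  exact h.seg (2 * x - 1) (2 * y - 1) (2 * z - 1) (2 * x' - 1) (2 * y' - 1) (2 * z' - 1) l h0 h1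
    (by linear_combination 4 * hn) (by ring) (by ring) (by ring)

theorem RC.chord {a b c : ℝ} {g : ℝ → ℝ → ℝ → ℝ} (h : RC a b c g) {X Y Z Δ : ℝ} (x y z x' y' z' r s : ℝ)
    (hr : 0 ≤ r) (hs : 0 ≤ s) (hrs : r + s = Δ) (hΔ : 0 < Δ)
    (hn : a * (x - x') * (y - y') + b * (y - y') * (z - z') + c * (x - x') * (z - z') = 0)
    (hX : Δ * X = r * x + s * x') (hY : Δ * Y = r * y + s * y')
    (hZ : Δ * Z = r * z + s * z') :
    Δ * g X Y Z ≤ r * g x y z + s * g x' y' z' := by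
  have hm' : Δ * (s / Δ) = s := by field_simp
  have hm : Δ * (1 - s / Δ) = r := by linarith
  have e := h.seg (X := X) (Y := Y) (Z := Z) x y z x' y' z' (s / Δ) (by positivity)
    (by rw [div_le_one hΔ]; linarith) hn
    (by apply mul_left_cancel₀ hΔ.ne'; rw [hX]; linear_combination -x * hm - x' * hm')
    (by apply mul_left_cancel₀ hΔ.ne'; rw [hY]; linear_combination -y * hm - y' * hm')
    (by apply mul_left_cancel₀ hΔ.ne'; rw [hZ]; linear_combination -z * hm - z' * hm')
  have := mul_le_mul_of_nonneg_left e hΔ.le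
  refine this.trans (le_of_eq ?_)
  linear_combination g x y z * hm + g x' y' z' * hm'

theorem RC.tri01 {a b c : ℝ} {g : ℝ → ℝ → ℝ → ℝ} (h : RC a b c g) (x y z : ℝ)
    (hx0 : 0 ≤ x) (hx1 : x ≤ 1) (hy0 : 0 ≤ y) (hy1 : y ≤ 1) (hz0 : 0 ≤ z) (hz1 : z ≤ 1) :
    g (2 * x - 1) (2 * y - 1) (2 * z - 1) ≤ triW g (2 * x - 1) (2 * y - 1) (2 * z - 1) :=
  h.tri _ _ _ (by linarith) (by linarith) (by linarith) (by linarith) (by linarith) (by linarith)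

theorem RC.J {u v w : ℝ} {g : ℝ → ℝ → ℝ → ℝ} (H : RC (v + w) (u + w) (u + v) g)
    (hu : 0 < u) (huv : u ≤ v) (hvw : v ≤ w)
    (hΘ : 2 * (u + v + w) * v * w ≤ (u + v) * (v + w) * (w + u)) :
    (2 * ((u + v) * (v + w) * (w + u)) * g 0 0 0 ≤ 2 * ((u + v) * (v + w) * (w + u)) * We g
      + 4 * u * v * w / (u + v) * ((u + v) * WA g - (u + w) * WB g + (v - w) * WX g)
      + (2 * ((u + v) * (v + w) * (w + u)) - 8 * u * v * w) * WX g) ∧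
    (2 * ((u + v) * (v + w) * (w + u)) * g 0 0 0 ≤ 2 * ((u + v) * (v + w) * (w + u)) * We g
      - 2 * u * (2*v^2*w*(u+v) - ((u + v) * (v + w) * (w + u) -2*(u + v + w)*v*w)*(w-v)) / (v * (u + w) * (u + v))
        * ((u + v) * WA g - (u + w) * WB g + (v - w) * WX g)
      + (2 * ((u + v) * (v + w) * (w + u)) - 8 * u * v * w) * WX g) := by
  have hv : 0 < v := by linarith
  have hw : 0 < w := by linarith
  have hΔ : 0 < u * v + v * w + w * u := by positivity
  obtain ⟨φ, hφ⟩ : ∃ φ, φ = ((u + v) * (v + w) * (w + u) - 2 * (u + v + w) * v * w) / (2 * u * v) := ⟨_, rfl⟩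
  have hφ0 : 0 ≤ φ := by rw [hφ]; apply div_nonneg (by linarith) (by positivity)
  have hφ1 : 0 ≤ u + v + w - φ := by
    have : φ ≤ u + v + w := by
      rw [hφ, div_le_iff₀ (by positivity)]
      have : 0 ≤ (u + w) * (v * (u + v) + w * (v - u)) := mul_nonneg (by positivity) (add_nonneg (by positivity) (mul_nonneg hw.le (by linarith)))
      nlinarith
    linarith
  have ce := H.aff.center hu hv hw hvw
  have c1 := H.aff.chord (X := v * (u + w) / (u * v + v * w + w * u)) (Y := w * (u + v) / (u * v + v * w + w * u))
          (Z := u * (v + w) / (u * v + v * w + w * u)) (Δ := u * v + v * w + w * u) 1 0 0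
          (v/(u+v)) 1 (u*(v+w)/(w*(u+v))) (u * v) (w * (u + v)) (by positivity) (by positivity) (by ring) hΔ
          (by field_simp; ring) (by field_simp; try ring) (by field_simp; try ring) (by field_simp; try ring)
  have c2 := H.aff.chord (X := v * (u + w) / (u * v + v * w + w * u)) (Y := w * (u + v) / (u * v + v * w + w * u))
          (Z := u * (v + w) / (u * v + v * w + w * u)) (Δ := u * v + v * w + w * u) 0 1 0
          1 (w/(u+w)) (u*(v+w)/(v*(u+w))) (u * w) (v * (u + w)) (by positivity) (by positivity) (by ring) hΔ
          (by field_simp; ring) (by field_simp; try ring) (by field_simp; try ring) (by field_simp; try ring)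
  have c3 := H.aff.chord (X := v * (u + w) / (u * v + v * w + w * u)) (Y := w * (u + v) / (u * v + v * w + w * u))
          (Z := u * (v + w) / (u * v + v * w + w * u)) (Δ := u * v + v * w + w * u) 0 0 1
          (v*(u+w)/(w*(u+v))) 1 (u/(u+v)) (u * v) (w * (u + v)) (by positivity) (by positivity) (by ring) hΔ
          (by field_simp; ring) (by field_simp; try ring) (by field_simp; try ring) (by field_simp; try ring)
  beta_reduce at ce c1 c2 c3
  have t0 := H.tri01 0 0 0 (by norm_num) (by norm_num) (by norm_num) (by norm_num) (by norm_num) (by norm_num)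
  have t1 := H.tri01 1 0 0 (by norm_num) (by norm_num) (by norm_num) (by norm_num) (by norm_num) (by norm_num)
  have t2 := H.tri01 0 1 0 (by norm_num) (by norm_num) (by norm_num) (by norm_num) (by norm_num) (by norm_num)
  have t3 := H.tri01 0 0 1 (by norm_num) (by norm_num) (by norm_num) (by norm_num) (by norm_num) (by norm_num)
  have E1 := H.tri01 (v/(u+v)) 1 (u*(v+w)/(w*(u+v))) (by positivity) (by rw [div_le_one (by positivity)]; linarith)
    (by norm_num) (by norm_num) (by positivity) (by rw [div_le_one (by positivity)]; nlinarith)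
  have E2 := H.tri01 1 (w/(u+w)) (u*(v+w)/(v*(u+w))) (by norm_num) (by norm_num)
    (by positivity) (by rw [div_le_one (by positivity)]; linarith) (by positivity) (by rw [div_le_one (by positivity)]; nlinarith)
  have E3 := H.tri01 (v*(u+w)/(w*(u+v))) 1 (u/(u+v)) (by positivity) (by rw [div_le_one (by positivity)]; nlinarith)
    (by norm_num) (by norm_num) (by positivity) (by rw [div_le_one (by positivity)]; linarith)
  have hhalf : g (2 * (1/2) - 1) (2 * (1/2) - 1) (2 * (1/2) - 1) = g 0 0 0 := by norm_num
  rw [hhalf] at ce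
  have d1 := (c1.trans (add_le_add (mul_le_mul_of_nonneg_left t1 (by positivity)) (mul_le_mul_of_nonneg_left E1 (by positivity))))
  have d2 := (c2.trans (add_le_add (mul_le_mul_of_nonneg_left t2 (by positivity)) (mul_le_mul_of_nonneg_left E2 (by positivity))))
  have d3 := (c3.trans (add_le_add (mul_le_mul_of_nonneg_left t3 (by positivity)) (mul_le_mul_of_nonneg_left E3 (by positivity))))
  have s0 := mul_le_mul_of_nonneg_left t0 (by positivity : 0 ≤ u * v * w)
  have s1 := mul_le_mul_of_nonneg_left t1 (by positivity : 0 ≤ u * w * (u + w))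
  have s2 := mul_le_mul_of_nonneg_left t2 (by positivity : 0 ≤ u * v * (u + v))
  have s3 := mul_le_mul_of_nonneg_left t3 (by positivity : 0 ≤ v * w * (v + w))
  have k1 := mul_le_mul_of_nonneg_left d1 hφ1
  have k2 := mul_le_mul_of_nonneg_left d2 hφ1
  have k3 := mul_le_mul_of_nonneg_left d3 hφ0
  generalize (u * v + v * w + w * u) * g (2 * (v * (u + w) / (u * v + v * w + w * u)) - 1)
        (2 * (w * (u + v) / (u * v + v * w + w * u)) - 1) (2 * (u * (v + w) / (u * v + v * w + w * u)) - 1) = hQ at *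
  clear c1 c2 c3 t0 t1 t2 t3 E1 E2 E3 d1 d2 d3 hhalf
  constructor
  · have := ce.trans (add_le_add (add_le_add (add_le_add (add_le_add s0 s1) s2) s3)
      ((by linarith : (u + v + w) * hQ = (u + v + w - φ) * hQ + φ * hQ).le.trans (add_le_add k1 k3)))
    refine this.trans (le_of_eq ?_)
    rw [hφ]
    unfold triW
    generalize We g = e
    generalize Wx g = ex
    generalize Wy g = ey
    generalize Wz g = ez
    generalize WA g = A
    generalize WB g = B
    generalize WC g = C
    generalize WX g = X
    field_simp
    ring
  · have := ce.trans (add_le_add (add_le_add (add_le_add (add_le_add s0 s1) s2) s3)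
      ((by linarith : (u + v + w) * hQ = (u + v + w - φ) * hQ + φ * hQ).le.trans (add_le_add k2 k3)))
    refine this.trans (le_of_eq ?_)
    rw [hφ]
    unfold triW
    generalize We g = e
    generalize Wx g = ex
    generalize Wy g = ey
    generalize Wz g = ez
    generalize WA g = A
    generalize WB g = B
    generalize WC g = C
    generalize WX g = X
    field_simp
    ring

theorem Qcase {u v w : ℝ} {g : ℝ → ℝ → ℝ → ℝ} (H : RC (v + w) (u + w) (u + v) g)
    (hu : 0 < u) (huv : u ≤ v) (hvw : v ≤ w)
    (hΘ : 2 * (u + v + w) * v * w ≤ (u + v) * (v + w) * (w + u)) (hX : WX g ≤ 0) :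
    g 0 0 0 ≤ We g + WX g / 2 := by
  have hv : 0 < v := by linarith
  have hw : 0 < w := by linarith
  obtain ⟨j1, j2⟩ := H.J hu huv hvw hΘ
  have hP : 8 * u * v * w ≤ (u + v) * (v + w) * (w + u) := by
    nlinarith [mul_nonneg hu.le (sq_nonneg (v - w)), mul_nonneg hv.le (sq_nonneg (u - w)), mul_nonneg hw.le (sq_nonneg (u - v))]
  have hP0 : 0 < 2 * ((u + v) * (v + w) * (w + u)) := by positivity
  have hX' := mul_nonneg (by linarith : 0 ≤ (u + v) * (v + w) * (w + u) - 8 * u * v * w) (by linarith : 0 ≤ - WX g)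
  refine le_of_mul_le_mul_left ?_ hP0
  rcases le_total ((u + v) * WA g - (u + w) * WB g + (v - w) * WX g) 0 with hY | hY
  · have := mul_nonpos_of_nonneg_of_nonpos (by positivity : 0 ≤ 4 * u * v * w / (u + v)) hY
    linarith
  · have hk : 0 ≤ 2 * u * (2*v^2*w*(u+v) - ((u + v) * (v + w) * (w + u) -2*(u + v + w)*v*w)*(w-v)) / (v * (u + w) * (u + v)) := by
      apply div_nonneg _ (by positivity)
      apply mul_nonneg (by positivity)
      have h1 : (u + v) * (v + w) * (w + u) -2*(u + v + w)*v*w ≤ 2 * v ^ 3 := by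
        have : 0 ≤ (v - u) * ((v + w) * (u + 2 * v + w) - 2 * v * w + v ^ 2 + (v-v)) := by
          apply mul_nonneg (by linarith)
          nlinarith [mul_pos hv hw, mul_pos hu hw, mul_pos hv hv, mul_pos hw hw, mul_pos hu hv]
        nlinarith [mul_nonneg (by linarith : 0 ≤ v - u) (sq_nonneg v)]
      have h2 := mul_le_mul_of_nonneg_right h1 (by linarith : 0 ≤ w - v)
      have h3 : 0 ≤ v ^ 2 * w * u := by positivity
      have h4 : 0 ≤ v ^ 4 := by positivity
      nlinarith
    have := mul_nonneg hk hY
    linarith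

theorem RC.scale {a b c : ℝ} {g : ℝ → ℝ → ℝ → ℝ} (h : RC a b c g) {k : ℝ} (hk : k ≠ 0) :
    RC (k * a) (k * b) (k * c) g := by
  intro x y z x' y' z' l h0 h1 hn
  refine h x y z x' y' z' l h0 h1 ?_
  apply mul_left_cancel₀ hk
  linear_combination hn

theorem half_sorted {b c : ℝ} {g : ℝ → ℝ → ℝ → ℝ} (h : RC 1 b c g) (hc : 0 ≤ c) (hcb : c ≤ b) (hb1 : b ≤ 1) :
    g 0 0 0 ≤ We g + WX g / 2 := by
  rcases le_total 0 (WX g) with hX | hX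
  · have := h.tri 0 0 0 (by norm_num) (by norm_num) (by norm_num) (by norm_num) (by norm_num) (by norm_num)
    unfold triW at this
    linarith
  rcases le_or_gt (b + c) 1 with hbc | hbc
  · exact case1 h (by linarith) hc hbc hX
  rcases lt_or_ge (4 * b * c) ((1 + b + c) * (1 - (b - c) ^ 2)) with hΘ | hΘ
  · exact Tcase h (by linarith) hcb hb1 hbc hΘ hX
  · have h2 := h.scale (two_ne_zero)
    refine Qcase (u := b + c - 1) (v := 1 + c - b) (w := 1 + b - c) ?_ (by linarith) (by linarith) (by linarith) (by nlinarith) hX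
    convert h2 using 1 <;> ring

def GG (a b c : ℝ) : Prop := ∀ g, RC a b c g → g 0 0 0 ≤ We g + WX g / 2 ∧ g 0 0 0 ≤ We g - WX g / 2

theorem GG_sorted {a b c : ℝ} (hc : 0 ≤ c) (hcb : c ≤ b) (hba : b ≤ a) : GG a b c := by
  have key : ∀ g, RC a b c g → g 0 0 0 ≤ We g + WX g / 2 := by
    intro g hg
    rcases (show 0 ≤ a by linarith).eq_or_lt with ha | ha
    · have hb : b = 0 := by linarith
      have hc' : c = 0 := by linarith
      subst hb hc' ha
      have : RC 1 0 0 g := by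
        intro x y z x' y' z' l h0 h1 _
        exact hg x y z x' y' z' l h0 h1 (by ring)
      exact half_sorted this le_rfl le_rfl (by norm_num)
    · have h2 := hg.scale (inv_ne_zero ha.ne')
      rw [inv_mul_cancel₀ ha.ne'] at h2
      refine half_sorted h2 (by positivity) (by gcongr) ?_
      rw [inv_mul_le_iff₀ ha]; linarith
  intro g hg
  refine ⟨key g hg, ?_⟩
  have h2 : RC a b c (fun x y z => g (-x) (-y) (-z)) := by
    intro x y z x' y' z' l h0 h1 hn
    exact hg.seg _ _ _ _ _ _ l h0 h1 (by linear_combination hn) (by ring) (by ring) (by ring)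
  have := key _ h2
  unfold We WX at *
  simp only [neg_neg, neg_zero] at this
  linarith

theorem GG_yz {a b c : ℝ} (h : GG c b a) : GG a b c := by
  intro g hg
  have := h _ hg.swapyz
  unfold We WX at *
  beta_reduce at this
  constructor <;> linarith [this.1, this.2]

theorem GG_xy {a b c : ℝ} (h : GG a c b) : GG a b c := by
  intro g hg
  have := h _ hg.swap
  unfold We WX at *
  beta_reduce at this
  constructor <;> linarith [this.1, this.2]

theorem GG_nonneg {a b c : ℝ} (ha : 0 ≤ a) (hb : 0 ≤ b) (hc : 0 ≤ c) : GG a b c := by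
  rcases le_total a b with h1 | h1 <;> rcases le_total b c with h2 | h2 <;> rcases le_total a c with h3 | h3
  · exact GG_yz (GG_sorted ha h1 h2)
  · exact GG_yz (GG_sorted ha h1 h2)
  · exact GG_xy (GG_yz (GG_sorted ha h3 h2))
  · exact GG_yz (GG_xy (GG_yz (GG_sorted hc h3 h1)))
  · exact GG_yz (GG_xy (GG_sorted hb h1 h3))
  · exact GG_xy (GG_sorted hb h2 h3)
  · exact GG_sorted hc h2 h1
  · exact GG_sorted hc h2 h1

theorem GG_x {a b c : ℝ} (h : GG (-a) b (-c)) : GG a b c := by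
  intro g hg
  have h2 : RC (-a) b (-c) (fun x y z => g (-x) y z) := by
    intro x y z x' y' z' l h0 h1 hn
    exact hg.seg _ _ _ _ _ _ l h0 h1 (by linear_combination hn) (by ring) (by ring) (by ring)
  have := h _ h2
  unfold We WX at *
  simp only [neg_neg, neg_zero] at this
  constructor <;> linarith [this.1, this.2]

theorem GG_neg {a b c : ℝ} (h : GG (-a) (-b) (-c)) : GG a b c := by
  intro g hg
  apply h
  intro x y z x' y' z' l h0 h1 hn
  exact hg x y z x' y' z' l h0 h1 (by linear_combination -hn)

theorem GG_z {a b c : ℝ} (h : GG a (-b) (-c)) : GG a b c := by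
  intro g hg
  have h2 : RC a (-b) (-c) (fun x y z => g x y (-z)) := by
    intro x y z x' y' z' l h0 h1 hn
    exact hg.seg _ _ _ _ _ _ l h0 h1 (by linear_combination hn) (by ring) (by ring) (by ring)
  have := h _ h2
  unfold We WX at *
  simp only [neg_neg, neg_zero] at this
  constructor <;> linarith [this.1, this.2]

theorem GG_all (a b c : ℝ) : GG a b c := by
  have n : ∀ {x : ℝ}, x ≤ 0 → 0 ≤ -x := fun h => by linarith
  rcases le_total 0 a with h1 | h1 <;> rcases le_total 0 b with h2 | h2 <;> rcases le_total 0 c with h3 | h3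
  · exact GG_nonneg h1 h2 h3
  · refine GG_neg (GG_x (GG_z ?_)); exact GG_nonneg (by linarith) (by linarith) (by linarith)
  · refine GG_neg (GG_x ?_); exact GG_nonneg (by linarith) (by linarith) (by linarith)
  · refine GG_z ?_; exact GG_nonneg (by linarith) (by linarith) (by linarith)
  · refine GG_neg (GG_z ?_); exact GG_nonneg (by linarith) (by linarith) (by linarith)
  · refine GG_x ?_; exact GG_nonneg (by linarith) (by linarith) (by linarith)
  · refine GG_x (GG_z ?_); exact GG_nonneg (by linarith) (by linarith) (by linarith)
  · refine GG_neg ?_; exact GG_nonneg (by linarith) (by linarith) (by linarith)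

theorem det_zero_of_rank {C : Matrix (Fin 2) (Fin 2) ℝ} (h : C.rank = 1) :
    C 0 0 * C 1 1 - C 0 1 * C 1 0 = 0 := by
  by_contra hd
  rw [← Matrix.det_fin_two] at hd
  have := Matrix.rank_of_det_ne_zero (A := C) hd
  simp at this
  omega

theorem rank_le_of_det {C : Matrix (Fin 2) (Fin 2) ℝ} (h : C 0 0 * C 1 1 - C 0 1 * C 1 0 = 0) :
    C.rank ≤ 1 := by
  rw [← Matrix.det_fin_two] at h
  by_contra hr
  have h2 : C.rank = 2 := by
    have := C.rank_le_card_width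
    simp at this
    omega
  have hs : Function.Surjective C.mulVec := by
    have : LinearMap.range C.mulVecLin = ⊤ := by
      apply Submodule.eq_top_of_finrank_eq
      rw [← Matrix.rank, h2]; simp
    exact LinearMap.range_eq_top.mp this
  rw [Matrix.mulVec_surjective_iff_isUnit, Matrix.isUnit_iff_isUnit_det, h] at hs
  simp at hs

/-- For rank-one matrices `C₁, C₂, C₃` in `ℝ^{2×2}`, every rank-one convex
function `f` satisfies the symmetric cube inequality with weights `1/16` and `3/16`. -/
theorem laminate_cube_one_sixteenth
    (C₁ C₂ C₃ : Matrix (Fin 2) (Fin 2) ℝ)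
    (hC₁ : C₁.rank = 1) (hC₂ : C₂.rank = 1) (hC₃ : C₃.rank = 1)
    (f : Matrix (Fin 2) (Fin 2) ℝ → ℝ)
    (hf : ∀ A B : Matrix (Fin 2) (Fin 2) ℝ, B.rank ≤ 1 →
      ConvexOn ℝ Set.univ (fun t : ℝ => f (A + t • B))) :
    f 0 ≤ (1/16) * (f (C₁ + C₂ + C₃) + f (C₁ - C₂ - C₃) + f (-C₁ + C₂ - C₃)
                      + f (-C₁ - C₂ + C₃))
        + (3/16) * (f (-C₁ - C₂ - C₃) + f (C₁ + C₂ - C₃) + f (C₁ - C₂ + C₃)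
                      + f (-C₁ + C₂ + C₃)) := by
  have d1 := det_zero_of_rank hC₁
  have d2 := det_zero_of_rank hC₂
  have d3 := det_zero_of_rank hC₃
  have hRC : RC (C₁ 0 0 * C₂ 1 1 + C₂ 0 0 * C₁ 1 1 - C₁ 0 1 * C₂ 1 0 - C₂ 0 1 * C₁ 1 0)
      (C₂ 0 0 * C₃ 1 1 + C₃ 0 0 * C₂ 1 1 - C₂ 0 1 * C₃ 1 0 - C₃ 0 1 * C₂ 1 0)
      (C₁ 0 0 * C₃ 1 1 + C₃ 0 0 * C₁ 1 1 - C₁ 0 1 * C₃ 1 0 - C₃ 0 1 * C₁ 1 0)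
      (fun x y z => f (x • C₁ + y • C₂ + z • C₃)) := by
    intro x y z x' y' z' l h0 h1 hn
    have hr : ((x' - x) • C₁ + (y' - y) • C₂ + (z' - z) • C₃).rank ≤ 1 := by
      apply rank_le_of_det
      simp only [Matrix.add_apply, Matrix.smul_apply, smul_eq_mul]
      linear_combination hn + (x' - x) ^ 2 * d1 + (y' - y) ^ 2 * d2 + (z' - z) ^ 2 * d3
    have hc := (hf (x • C₁ + y • C₂ + z • C₃) _ hr).2 (Set.mem_univ 0) (Set.mem_univ 1)
      (by linarith : 0 ≤ 1 - l) h0 (by ring)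
    simp only [smul_eq_mul, mul_zero, zero_add, mul_one, zero_smul, add_zero, one_smul] at hc
    have e1 : x • C₁ + y • C₂ + z • C₃ + ((x' - x) • C₁ + (y' - y) • C₂ + (z' - z) • C₃)
        = x' • C₁ + y' • C₂ + z' • C₃ := by module
    have e2 : x • C₁ + y • C₂ + z • C₃ + l • ((x' - x) • C₁ + (y' - y) • C₂ + (z' - z) • C₃)
        = ((1 - l) * x + l * x') • C₁ + ((1 - l) * y + l * y') • C₂ + ((1 - l) * z + l * z') • C₃ := by
      module
    rw [e1, e2] at hc
    exact hc
  have key := (GG_all _ _ _ _ hRC).2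
  unfold We WX at key
  simp only [zero_smul, add_zero, one_smul, neg_smul, ← sub_eq_add_neg] at key
  linarith
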